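/- Let d₁, d₂ be odd positive integers with d₁ ∣ d₂, D = diag(d₁,d₂), and d = d₁d₂. If N ∈ Sp₄(ℤ) satisfies N ≡ I₄ (mod d²) entrywise, then the matrix R = diag(I₂, D)·N·diag(I₂, D⁻¹) has integer entries, lies in Γ_D(D), and R ≡ N (mod 2) entrywise. -/

import Mathlib

open Matrix

/-- The matrix `J_D = [[0, D], [−D, 0]]` over `ℤ`, for `D = diag(d₁,d₂)`. -/
def JD (d1 d2 : ℤ) : Matrix (Fin 4) (Fin 4) ℤ :=
  !![0, 0, d1, 0; 0, 0, 0, d2; -d1, 0, 0, 0; 0, -d2, 0, 0]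

/-- The standard symplectic matrix `J = [[0, I₂], [−I₂, 0]]` over `ℤ`. -/
def Jmat : Matrix (Fin 4) (Fin 4) ℤ := JD 1 1

/-- The block-diagonal matrix `diag(I₂, diag(a,b))` over `ℚ`. -/
def Ediag (a b : ℚ) : Matrix (Fin 4) (Fin 4) ℚ :=
  !![1, 0, 0, 0; 0, 1, 0, 0; 0, 0, a, 0; 0, 0, 0, b]

/-- The vector `(d₁, d₂, d₁, d₂)` of row divisibilities. -/
def dvec (d1 d2 : ℤ) : Fin 4 → ℤ := ![d1, d2, d1, d2]

/-- Membership in `Γ_D(D)`: `M·J_D·Mᵀ = J_D` and each block of `M − I₄` is of the form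
`D·Y`, i.e. rows `0,2` of `M − I₄` are divisible by `d₁` and rows `1,3` by `d₂`. -/
def InGammaDD (d1 d2 : ℤ) (M : Matrix (Fin 4) (Fin 4) ℤ) : Prop :=
  M * JD d1 d2 * Mᵀ = JD d1 d2 ∧ ∀ i j, dvec d1 d2 i ∣ (M - 1) i j

/-- Let `d₁, d₂` be odd positive integers with `d₁ ∣ d₂`, `D = diag(d₁,d₂)`, `d = d₁d₂`.
If `N ∈ Sp₄(ℤ)` and `N ≡ I₄ (mod d²)` entrywise, then `diag(I₂,D)·N·diag(I₂,D⁻¹)` has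
integer entries, i.e. it equals (the rational image of) an integer matrix `R`, which
lies in `Γ_D(D)` and satisfies `R ≡ N (mod 2)` entrywise. -/
theorem statement5 (d1 d2 : ℤ) (h1 : Odd d1) (h1p : 0 < d1) (h2 : Odd d2) (h2p : 0 < d2)
    (hdvd : d1 ∣ d2)
    (N : Matrix (Fin 4) (Fin 4) ℤ) (hN : N * Jmat * Nᵀ = Jmat)
    (hcong : ∀ i j, (d1 * d2) ^ 2 ∣ (N - 1) i j) :
    ∃ R : Matrix (Fin 4) (Fin 4) ℤ,
      R.map (Int.cast : ℤ → ℚ) =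
        Ediag (d1 : ℚ) (d2 : ℚ) * N.map (Int.cast : ℤ → ℚ) * Ediag (d1 : ℚ)⁻¹ (d2 : ℚ)⁻¹ ∧
      InGammaDD d1 d2 R ∧
      ∀ i j, (2 : ℤ) ∣ (R - N) i j := by
  choose K hK using hcong
  set e : Fin 4 → ℤ := ![1, 1, d1, d2] with he
  set f : Fin 4 → ℤ := ![d1 * d2, d1 * d2, d2, d1] with hf
  have hef : ∀ j, e j * f j = d1 * d2 := by
    intro j; fin_cases j <;> simp [he, hf, mul_comm]
  have he0 : ∀ j, e j ≠ 0 := by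
    intro j; fin_cases j <;> simp [he, h1p.ne', h2p.ne']
  have heo : ∀ j, Odd (e j) := by
    intro j; fin_cases j <;> simp [he, h1, h2]
  have hd : ∀ i, dvec d1 d2 i ∣ d1 * d2 := by
    intro i; fin_cases i <;> simp [dvec]
  let R : Matrix (Fin 4) (Fin 4) ℤ := 1 + Matrix.of (fun i j => e i * f j * (d1 * d2) * K i j)
  have hR : ∀ i j, (R - 1) i j = e i * f j * (d1 * d2) * K i j := by
    intro i j; simp [R]
  have key : ∀ i j, R i j * e j = e i * N i j := by
    intro i j
    have a := hR i j
    have b := hK i j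
    have c := hef j
    rw [Matrix.sub_apply] at a b
    have a' : R i j = (1 : Matrix (Fin 4) (Fin 4) ℤ) i j + e i * f j * (d1 * d2) * K i j := by
      linarith
    have b' : N i j = (1 : Matrix (Fin 4) (Fin 4) ℤ) i j + (d1 * d2) ^ 2 * K i j := by
      linarith
    have o : (1 : Matrix (Fin 4) (Fin 4) ℤ) i j * e j = e i * (1 : Matrix (Fin 4) (Fin 4) ℤ) i j := by
      by_cases h : i = j
      · subst h; simp
      · simp [Matrix.one_apply_ne h]
    rw [a', b', add_mul, mul_add, o]
    linear_combination (e i * (d1 * d2) * K i j) * c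
  have hmat : R * diagonal e = diagonal e * N := by
    ext i j
    rw [Matrix.mul_diagonal, Matrix.diagonal_mul, key]
  have hJ : JD d1 d2 = diagonal e * Jmat * diagonal e := by
    ext i j
    rw [Matrix.mul_diagonal, Matrix.diagonal_mul]
    fin_cases i <;> fin_cases j <;> simp [JD, Jmat, he]
  have hE : ∀ a b : ℚ, Ediag a b = diagonal ![1, 1, a, b] := by
    intro a b
    ext i j
    fin_cases i <;> fin_cases j <;> simp [Ediag]
  refine ⟨R, ?_, ⟨?_, ?_⟩, ?_⟩
  · ext i j
    rw [hE, hE, Matrix.mul_diagonal, Matrix.diagonal_mul, Matrix.map_apply, Matrix.map_apply]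
    have x1 : (![1, 1, (d1 : ℚ), (d2 : ℚ)] : Fin 4 → ℚ) i = (e i : ℚ) := by
      fin_cases i <;> simp [he]
    have x2 : (![1, 1, (d1 : ℚ)⁻¹, (d2 : ℚ)⁻¹] : Fin 4 → ℚ) j = (e j : ℚ)⁻¹ := by
      fin_cases j <;> simp [he]
    rw [x1, x2]
    have h0 : (e j : ℚ) ≠ 0 := by exact_mod_cast he0 j
    rw [eq_mul_inv_iff_mul_eq₀ h0]
    exact_mod_cast key i j
  · have ht : diagonal e * Rᵀ = Nᵀ * diagonal e := by
      have := congrArg Matrix.transpose hmat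
      simpa [Matrix.transpose_mul] using this
    calc R * JD d1 d2 * Rᵀ = (R * diagonal e) * Jmat * (diagonal e * Rᵀ) := by
          rw [hJ]; simp only [Matrix.mul_assoc]
      _ = diagonal e * (N * Jmat * Nᵀ) * diagonal e := by
          rw [hmat, ht]; simp only [Matrix.mul_assoc]
      _ = JD d1 d2 := by rw [hN, hJ]
  · intro i j
    rw [hR]
    exact Dvd.dvd.mul_right (Dvd.dvd.mul_left (hd i) _) _
  · intro i j
    rw [Matrix.sub_apply]
    have k := key i j
    obtain ⟨a, ha⟩ := heo i
    obtain ⟨b, hb⟩ := heo j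
    rw [ha, hb] at k
    exact ⟨a * N i j - b * R i j, by linear_combination k⟩
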